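/- The language {0^n 1^n | n ≥ 0} over the alphabet Σ = {0,1} is not definable by any sentence of FOC[+;MOD]. -/

import Mathlib

namespace FOC

/-- Count terms: affine combinations `c₀ + c₁·x₁ + ⋯ + cₖ·xₖ` with rational
coefficients over count variables (named by naturals). -/
structure CTerm where
  const : ℚ
  coeffs : List (ℚ × ℕ)

/-- Evaluate a count term under a count-variable assignment. -/
def CTerm.eval (t : CTerm) (ν : ℕ → ℚ) : ℚ :=
  t.const + (t.coeffs.map fun c => c.1 * ν c.2).sum

/-- The count variables occurring in a count term. -/
def CTerm.vars (t : CTerm) : Finset ℕ :=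
  (t.coeffs.map Prod.snd).toFinset

/-- The count term consisting of a single variable. -/
def CTerm.var (x : ℕ) : CTerm := ⟨0, [(1, x)]⟩

/-- A constant count term. -/
def CTerm.cst (c : ℚ) : CTerm := ⟨c, []⟩

/-- Formulas of FOC[+;MOD] over the alphabet `A`.  Position variables and
count variables are both named by naturals (the two sorts are separate). -/
inductive Formula (A : Type) : Type
  | tru : Formula A
  | fls : Formula A
  | qa (a : A) (p : ℕ) : Formula A
  | mod (r m : ℕ) (p : ℕ) : Formula A
  | eq (t₁ t₂ : CTerm) : Formula A
  | lt (t₁ t₂ : CTerm) : Formula A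
  | and (φ ψ : Formula A) : Formula A
  | or (φ ψ : Formula A) : Formula A
  | not (φ : Formula A) : Formula A
  | exC (x : ℕ) (φ : Formula A) : Formula A
  | allC (x : ℕ) (φ : Formula A) : Formula A
  | cnt (x : ℕ) (p : ℕ) (φ : Formula A) : Formula A

variable {A : Type}

open Classical in
/-- Satisfaction of a formula in a string `w` (positions are `1,…,w.length`;
the letter at position `p` is `w[p-1]`), under a position assignment `ρ` and a
count assignment `ν`.  The counting quantifier `cnt x p φ` holds iff the number
of positions `j ∈ [1, w.length]` satisfying `φ` equals `ν x`. -/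
def Sat (w : List A) : (ℕ → ℕ) → (ℕ → ℚ) → Formula A → Prop
  | _, _, .tru => True
  | _, _, .fls => False
  | ρ, _, .qa a p => w[ρ p - 1]? = some a
  | ρ, _, .mod r m p => ρ p % m = r % m
  | _, ν, .eq t₁ t₂ => t₁.eval ν = t₂.eval ν
  | _, ν, .lt t₁ t₂ => t₁.eval ν < t₂.eval ν
  | ρ, ν, .and φ ψ => Sat w ρ ν φ ∧ Sat w ρ ν ψ
  | ρ, ν, .or φ ψ => Sat w ρ ν φ ∨ Sat w ρ ν ψ
  | ρ, ν, .not φ => ¬ Sat w ρ ν φ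
  | ρ, ν, .exC x φ => ∃ q : ℚ, Sat w ρ (Function.update ν x q) φ
  | ρ, ν, .allC x φ => ∀ q : ℚ, Sat w ρ (Function.update ν x q) φ
  | ρ, ν, .cnt x p φ =>
      (((Finset.Icc 1 w.length).filter
          (fun j => Sat w (Function.update ρ p j) ν φ)).card : ℚ) = ν x

/-- Free position variables of a formula. -/
def freePos : Formula A → Finset ℕ
  | .tru => ∅
  | .fls => ∅
  | .qa _ p => {p}
  | .mod _ _ p => {p}
  | .eq _ _ => ∅
  | .lt _ _ => ∅
  | .and φ ψ => freePos φ ∪ freePos ψ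
  | .or φ ψ => freePos φ ∪ freePos ψ
  | .not φ => freePos φ
  | .exC _ φ => freePos φ
  | .allC _ φ => freePos φ
  | .cnt _ p φ => freePos φ \ {p}

/-- Free count variables of a formula. -/
def freeCount : Formula A → Finset ℕ
  | .tru => ∅
  | .fls => ∅
  | .qa _ _ => ∅
  | .mod _ _ _ => ∅
  | .eq t₁ t₂ => t₁.vars ∪ t₂.vars
  | .lt t₁ t₂ => t₁.vars ∪ t₂.vars
  | .and φ ψ => freeCount φ ∪ freeCount ψ
  | .or φ ψ => freeCount φ ∪ freeCount ψ
  | .not φ => freeCount φ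
  | .exC x φ => freeCount φ \ {x}
  | .allC x φ => freeCount φ \ {x}
  | .cnt x _ φ => freeCount φ ∪ {x}

/-- Quantifier-free formulas (no `∃x`, `∀x`, and no counting quantifier). -/
def QFree : Formula A → Prop
  | .and φ ψ => QFree φ ∧ QFree ψ
  | .or φ ψ => QFree φ ∧ QFree ψ
  | .not φ => QFree φ
  | .exC _ _ => False
  | .allC _ _ => False
  | .cnt _ _ _ => False
  | _ => True

/-- Two formulas are equivalent if they have the same truth value in every
string under every assignment of the (position and count) variables. -/
def FOCEquiv (φ ψ : Formula A) : Prop :=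
  ∀ (w : List A) (ρ : ℕ → ℕ) (ν : ℕ → ℚ), Sat w ρ ν φ ↔ Sat w ρ ν ψ

/-- A sentence is a formula without free variables. -/
def IsSentence (φ : Formula A) : Prop := freePos φ = ∅ ∧ freeCount φ = ∅

/-- The language defined by a sentence. -/
def Defines (σ : Formula A) (L : Set (List A)) : Prop :=
  ∀ w, w ∈ L ↔ Sat w (fun _ => 1) (fun _ => 0) σ

/-- Finite conjunction. -/
def bigAnd (l : List (Formula A)) : Formula A := l.foldr .and .tru

/-- Finite disjunction. -/
def bigOr (l : List (Formula A)) : Formula A := l.foldr .or .fls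

/-- Iterated existential count quantification `∃x₁.…∃xₖ. φ`. -/
def exCs (xs : List ℕ) (φ : Formula A) : Formula A := xs.foldr .exC φ

end FOC

/-- The language `{0ⁿ1ⁿ | n ≥ 0}` over `{0,1}` (with `0 = false`, `1 = true`). -/
def Lzn1n : Set (List Bool) :=
  {w | ∃ n : ℕ, w = List.replicate n false ++ List.replicate n true}

/-- A number whose multiples are respected by all modular predicates of a formula: it is divisible
by every nonzero modulus, and exceeds every position named by a predicate of modulus `0`. -/
def FOC.modulus {A : Type} : FOC.Formula A → ℕ
  | .mod r m _ => if m = 0 then r + 1 else m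
  | .and φ ψ => modulus φ * modulus ψ
  | .or φ ψ => modulus φ * modulus ψ
  | .not φ => modulus φ
  | .exC _ φ => modulus φ
  | .allC _ φ => modulus φ
  | .cnt _ _ φ => modulus φ
  | _ => 1

lemma FOC.modulus_pos {A : Type} (φ : FOC.Formula A) : 0 < FOC.modulus φ := by
  induction φ <;> simp_all [FOC.modulus]
  split_ifs <;> omega

/-- Swapping two positions beyond `K` that are congruent modulo `K` preserves satisfaction of every
formula whose modulus divides `K`. -/
lemma FOC.sat_swap_iff {A : Type} {K i j : ℕ} (hK : 0 < K) (hi : K < i) (hj : K < j)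
    (hij : i ≡ j [MOD K]) {w w' : List A} (hlen : w'.length = w.length)
    (hiw : i ≤ w.length) (hjw : j ≤ w.length)
    (hw : ∀ p, w'[Equiv.swap i j p - 1]? = w[p - 1]?) (φ : FOC.Formula A) :
    FOC.modulus φ ∣ K → ∀ (ρ : ℕ → ℕ) (ν : ℕ → ℚ),
      FOC.Sat w ρ ν φ ↔ FOC.Sat w' (Equiv.swap i j ∘ ρ) ν φ := by
  induction φ with
  | tru => simp [FOC.Sat]
  | fls => simp [FOC.Sat]
  | qa a p => simp [FOC.Sat, hw]
  | mod r m p =>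
    intro hd ρ ν
    simp only [FOC.modulus] at hd
    simp only [FOC.Sat, Function.comp_apply, Equiv.swap_apply_def]
    split_ifs at hd with hm
    · have := Nat.le_of_dvd hK hd
      subst hm
      simp only [Nat.mod_zero]
      split_ifs <;> omega
    · have h : i % m = j % m := hij.of_dvd hd
      split_ifs with h₁ h₂
      · rw [h₁, h]
      · rw [h₂, h]
      · rfl
  | eq t₁ t₂ => simp [FOC.Sat]
  | lt t₁ t₂ => simp [FOC.Sat]
  | and φ ψ ihφ ihψ =>
    intro hd ρ ν
    simp only [FOC.Sat]
    rw [ihφ (dvd_of_mul_right_dvd hd), ihψ (dvd_of_mul_left_dvd hd)]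
  | or φ ψ ihφ ihψ =>
    intro hd ρ ν
    simp only [FOC.Sat]
    rw [ihφ (dvd_of_mul_right_dvd hd), ihψ (dvd_of_mul_left_dvd hd)]
  | not φ ih => exact fun hd ρ ν => not_congr (ih hd ρ ν)
  | exC x φ ih => exact fun hd ρ ν => exists_congr fun q => ih hd ρ _
  | allC x φ ih => exact fun hd ρ ν => forall_congr' fun q => ih hd ρ _
  | cnt x p φ ih =>
    intro hd ρ ν
    classical
    simp only [FOC.Sat, hlen]
    rw [Finset.card_equiv (Equiv.swap i j)]
    intro k
    rw [Finset.mem_filter, Finset.mem_filter, ih hd, Function.comp_update]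
    refine and_congr_left fun _ => ?_
    simp only [Finset.mem_Icc, Equiv.swap_apply_def]
    split_ifs <;> omega

/-- **Proposition 4 (second half).** `{0ⁿ1ⁿ | n ≥ 0}` is not definable by any
sentence of FOC[+;MOD]. -/
theorem zn1n_not_foc_definable :
    ¬ ∃ σ : FOC.Formula Bool, FOC.IsSentence σ ∧ FOC.Defines σ Lzn1n := by
  rintro ⟨σ, -, hσ⟩
  set K := FOC.modulus σ with hKdef
  have hK : 0 < K := FOC.modulus_pos σ
  set w := List.replicate (K + 2) false ++ List.replicate (K + 2) true with hwdef
  set w' := (w.set (K + 1) true).set (2 * K + 1) false with hw'def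
  have hlen : w'.length = w.length := by simp [hw'def]
  have hwlen : w.length = 2 * K + 4 := by simp [hwdef]; omega
  have hget (k : ℕ) : w[k]? =
      if k < K + 2 then some false else if k < 2 * K + 4 then some true else none := by
    rw [hwdef, List.getElem?_append, List.getElem?_replicate, List.getElem?_replicate,
      List.length_replicate]
    split_ifs <;> first | rfl | omega
  have hget' (k : ℕ) : w'[k]? = if k = 2 * K + 1 then some false else
      if k = K + 1 then some true else w[k]? := by
    rw [hw'def, List.getElem?_set, List.getElem?_set, List.length_set, hwlen]
    split_ifs <;> first | rfl | omega
  have hmod : K + 2 ≡ 2 * K + 2 [MOD K] := by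
    simp [Nat.ModEq, Nat.add_mod]
  have hsat := FOC.sat_swap_iff hK (i := K + 2) (j := 2 * K + 2) (by omega) (by omega) hmod hlen
    (by omega) (by omega) (fun p => by
      rw [hget', hget, hget, Equiv.swap_apply_def]
      split_ifs <;> first | rfl | omega) σ hKdef.symm.dvd (fun _ => 1) (fun _ => 0)
  have hfix : Equiv.swap (K + 2) (2 * K + 2) ∘ (fun _ : ℕ => 1) = fun _ => 1 := by
    funext x
    exact Equiv.swap_apply_of_ne_of_ne (show 1 ≠ K + 2 by omega) (show 1 ≠ 2 * K + 2 by omega)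
  rw [hfix, ← hσ, ← hσ] at hsat
  obtain ⟨n, hn⟩ := hsat.1 ⟨K + 2, rfl⟩
  have hnlen := congrArg List.length hn
  rw [hlen, hwlen, List.length_append, List.length_replicate, List.length_replicate] at hnlen
  obtain rfl : n = K + 2 := by omega
  have h := hget' (K + 1)
  rw [hn, ← hwdef, hget, if_pos (by omega), if_neg (by omega), if_pos rfl] at h
  simp at h
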